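/- Let F : (0,∞) → (0,∞) be a function and define G(x) := x η²(F(x)) for x > 0. Assume G is a continuously differentiable, strictly increasing bijection of (0,∞) onto (0,∞) with G'(x) > 0 for all x > 0, and define σ̂(S) := (1/S) · G⁻¹(S) · G'(G⁻¹(S)) · σ(G⁻¹(S)) for S > 0. Then inf { (1/2) ∫₀¹ ( h'(t)/σ(e^{h(t)}) )² dt : h : [0,1] → ℝ absolutely continuous with square-integrable derivative, h(0) = log V₀, ∫₀¹ e^{h(t)} η²(F(e^{h(t)})) dt = K } = inf { (1/2) ∫₀¹ ( g'(t)/σ̂(e^{g(t)}) )² dt : g : [0,1] → ℝ absolutely continuous with square-integrable derivative, g(0) = log G(V₀), ∫₀¹ e^{g(t)} dt = K }. -/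

import Mathlib

open MeasureTheory

/-- `f : [0,1] → ℝ` is absolutely continuous with square-integrable derivative `f'`. -/
def AC (f f' : ℝ → ℝ) : Prop :=
  IntervalIntegrable f' MeasureTheory.volume 0 1 ∧
  IntervalIntegrable (fun t => (f' t) ^ 2) MeasureTheory.volume 0 1 ∧
  ∀ t ∈ Set.Icc (0 : ℝ) 1, f t = f 0 + ∫ s in (0 : ℝ)..t, f' s

/-- The functional `Λ_ρ[g,h]` (with chosen derivatives `g'`, `h'`). -/
noncomputable def Lam (η σ : ℝ → ℝ) (ρ : ℝ) (g g' h h' : ℝ → ℝ) : ℝ :=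
  (1 / (2 * (1 - ρ ^ 2))) *
    (∫ t in (0 : ℝ)..1,
      (g' t / (η (Real.exp (g t)) * Real.sqrt (Real.exp (h t))) -
        ρ * h' t / σ (Real.exp (h t))) ^ 2) +
  (1 / 2) * (∫ t in (0 : ℝ)..1, (h' t / σ (Real.exp (h t))) ^ 2)

/-- Admissible values of the variational problem defining the rate function. -/
def RateValues (η σ : ℝ → ℝ) (ρ S₀ V₀ K : ℝ) : Set ℝ :=
  {y | ∃ g g' h h' : ℝ → ℝ, AC g g' ∧ AC h h' ∧
    g 0 = Real.log S₀ ∧ h 0 = Real.log V₀ ∧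
    (∫ t in (0 : ℝ)..1, Real.exp (h t) * (η (Real.exp (g t))) ^ 2) = K ∧
    y = Lam η σ ρ g g' h h'}

/-- The rate function `I_ρ(S₀,V₀,K)`. -/
noncomputable def RateI (η σ : ℝ → ℝ) (ρ S₀ V₀ K : ℝ) : ℝ :=
  sInf (RateValues η σ ρ S₀ V₀ K)

theorem LipschitzOnWith.comp_absolutelyContinuousOnInterval {X Y : Type*} [PseudoMetricSpace X]
    [PseudoMetricSpace Y] {φ : X → Y} {C : NNReal} {s : Set X} (hφ : LipschitzOnWith C φ s)
    {f : ℝ → X} {a b : ℝ} (hf : AbsolutelyContinuousOnInterval f a b)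
    (hs : Set.MapsTo f (Set.uIcc a b) s) :
    AbsolutelyContinuousOnInterval (fun t => φ (f t)) a b := by
  unfold AbsolutelyContinuousOnInterval at hf ⊢
  refine squeeze_zero' (Filter.Eventually.of_forall fun _ => Finset.sum_nonneg fun _ _ =>
    dist_nonneg) ?_ (by simpa using hf.const_mul (C : ℝ))
  rw [Filter.eventually_inf_principal]
  filter_upwards with E hE
  rw [Finset.mul_sum]
  exact Finset.sum_le_sum fun i hi =>
    hφ.dist_le_mul _ (hs (hE.1 i hi).1) _ (hs (hE.1 i hi).2)

theorem AC.absolutelyContinuousOnInterval {f f' : ℝ → ℝ} (hf : AC f f') :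
    AbsolutelyContinuousOnInterval (fun t => f 0 + ∫ s in (0 : ℝ)..t, f' s) 0 1 :=
  AbsolutelyContinuousOnInterval.fun_add
    (LipschitzWith.const (f 0)).lipschitzOnWith.absolutelyContinuousOnInterval
    (hf.1.absolutelyContinuousOnInterval_intervalIntegral (by simp))

theorem AC.continuousOn {f f' : ℝ → ℝ} (hf : AC f f') :
    ContinuousOn f (Set.uIcc 0 1) :=
  hf.absolutelyContinuousOnInterval.continuousOn.congr fun t ht =>
    hf.2.2 t (by rwa [Set.uIcc_of_le zero_le_one] at ht)

/-- The chain rule for a `C¹` function composed with an absolutely continuous one. -/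
theorem AC.comp {f f' φ φ' : ℝ → ℝ} (hf : AC f f') (hφ : ∀ x, HasDerivAt φ (φ' x) x)
    (hφ' : Continuous φ') : AC (fun t => φ (f t)) (fun t => φ' (f t) * f' t) := by
  have hc : ContinuousOn (fun t => φ' (f t)) (Set.uIcc 0 1) := hφ'.comp_continuousOn hf.continuousOn
  have hint : IntervalIntegrable (fun t => φ' (f t) * f' t) volume 0 1 :=
    hf.1.continuousOn_mul hc
  refine ⟨hint, ?_, ?_⟩
  · simpa only [mul_pow, Pi.pow_apply] using hf.2.1.continuousOn_mul (hc.pow 2)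
  have hF := hf.absolutelyContinuousOnInterval
  have hfF : ∀ t ∈ Set.uIcc (0 : ℝ) 1, f t = f 0 + ∫ s in (0 : ℝ)..t, f' s := fun t ht =>
    hf.2.2 t (by rwa [Set.uIcc_of_le zero_le_one] at ht)
  obtain ⟨R, hR⟩ := hF.exists_bound
  obtain ⟨C, hC⟩ := (isCompact_Icc (a := -R) (b := R)).exists_bound_of_continuousOn
    hφ'.continuousOn
  have hlip : LipschitzOnWith C.toNNReal φ (Set.Icc (-R) R) :=
    (convex_Icc _ _).lipschitzOnWith_of_nnnorm_hasDerivWithin_le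
      (fun x _ => (hφ x).hasDerivWithinAt)
      (fun x hx => NNReal.le_toNNReal_of_coe_le (hC x hx))
  have hφF := hlip.comp_absolutelyContinuousOnInterval hF fun t ht => abs_le.1 (hR t ht)
  have hD := hφF.fun_sub
    (hint.absolutelyContinuousOnInterval_intervalIntegral (c := 0) (by simp))
  obtain ⟨c, hc⟩ := hD.const_of_ae_hasDerivAt_zero (by
    filter_upwards [hf.1.ae_hasDerivAt_integral, hint.ae_hasDerivAt_integral] with x h₁ h₂ hx
    have h₃ := ((hφ _).comp x ((h₁ hx 0 (by simp)).const_add (f 0))).sub (h₂ hx 0 (by simp))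
    rwa [← hfF x hx, sub_self] at h₃)
  intro t ht
  have ht' : t ∈ Set.uIcc (0 : ℝ) 1 := by rwa [Set.uIcc_of_le zero_le_one]
  have h₀ := hc 0 (by simp)
  have h₁ := hc t ht'
  simp only [← hfF t ht', intervalIntegral.integral_same, add_zero, sub_zero] at h₀ h₁
  linarith

/-- with `G(x) = x η²(F(x))` a `C¹` strictly increasing bijection of
`(0,∞)` onto itself with positive derivative, the one-dimensional variational problem with
constraint `∫₀¹ e^{h} η²(F(e^{h})) dt = K` equals the Asian-option variational problem with
local volatility `σ̂(S) = (1/S) G⁻¹(S) G'(G⁻¹(S)) σ(G⁻¹(S))`, spot `G(V₀)` and strike `K`. -/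
theorem variational_change_of_variables
    (V₀ K : ℝ) (hV₀ : 0 < V₀) (hK : 0 < K)
    (η σ : ℝ → ℝ)
    (hηc : ContinuousOn η (Set.Ioi 0)) (hσc : ContinuousOn σ (Set.Ioi 0))
    (mη Mη mσ Mσ : ℝ) (hmη : 0 < mη) (hmσ : 0 < mσ)
    (hηb : ∀ x ∈ Set.Ioi (0 : ℝ), mη ≤ η x ∧ η x ≤ Mη)
    (hσb : ∀ x ∈ Set.Ioi (0 : ℝ), mσ ≤ σ x ∧ σ x ≤ Mσ)
    (F G G' Ginv σhat : ℝ → ℝ)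
    (hFpos : ∀ x, 0 < x → 0 < F x)
    (hGdef : ∀ x, 0 < x → G x = x * (η (F x)) ^ 2)
    (hGdiff : ∀ x ∈ Set.Ioi (0 : ℝ), HasDerivAt G (G' x) x)
    (hG'c : ContinuousOn G' (Set.Ioi 0))
    (hG'pos : ∀ x ∈ Set.Ioi (0 : ℝ), 0 < G' x)
    (hGmono : StrictMonoOn G (Set.Ioi 0))
    (hGpos : ∀ x ∈ Set.Ioi (0 : ℝ), 0 < G x)
    (hGsurj : ∀ y, 0 < y → ∃ x, 0 < x ∧ G x = y)
    (hGinvl : ∀ x, 0 < x → Ginv (G x) = x)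
    (hGinvr : ∀ y, 0 < y → G (Ginv y) = y)
    (hσhat : ∀ S, 0 < S →
      σhat S = (1 / S) * Ginv S * G' (Ginv S) * σ (Ginv S)) :
    sInf {y | ∃ h h' : ℝ → ℝ, AC h h' ∧ h 0 = Real.log V₀ ∧
        (∫ t in (0 : ℝ)..1, Real.exp (h t) * (η (F (Real.exp (h t)))) ^ 2) = K ∧
        y = (1 / 2) * (∫ t in (0 : ℝ)..1, (h' t / σ (Real.exp (h t))) ^ 2)} =
      sInf {y | ∃ g g' : ℝ → ℝ, AC g g' ∧ g 0 = Real.log (G V₀) ∧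
        (∫ t in (0 : ℝ)..1, Real.exp (g t)) = K ∧
        y = (1 / 2) * (∫ t in (0 : ℝ)..1, (g' t / σhat (Real.exp (g t))) ^ 2)} := by
  have hexp : ∀ u, Real.exp u ∈ Set.Ioi (0 : ℝ) := Real.exp_pos
  have hGinvpos : ∀ y, 0 < y → 0 < Ginv y := fun y hy => by
    obtain ⟨x, hx, rfl⟩ := hGsurj y hy
    rwa [hGinvl x hx]
  let φ : ℝ → ℝ := fun u => Real.log (G (Real.exp u))
  let φ' : ℝ → ℝ := fun u => G' (Real.exp u) * Real.exp u / G (Real.exp u)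
  let ψ : ℝ → ℝ := fun v => Real.log (Ginv (Real.exp v))
  have hexpφ : ∀ u, Real.exp (φ u) = G (Real.exp u) := fun u => Real.exp_log (hGpos _ (hexp u))
  have hψφ : ∀ u, ψ (φ u) = u := fun u => by
    simp only [ψ, hexpφ, hGinvl _ (hexp u), Real.log_exp]
  have hφψ : ∀ v, φ (ψ v) = v := fun v => by
    simp only [φ, ψ, Real.exp_log (hGinvpos _ (hexp v)), hGinvr _ (hexp v), Real.log_exp]
  have hφd : ∀ u, HasDerivAt φ (φ' u) u := fun u =>
    ((hGdiff _ (hexp u)).comp u (Real.hasDerivAt_exp u)).log (hGpos _ (hexp u)).ne'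
  have hGc : ContinuousOn G (Set.Ioi 0) := fun x hx =>
    (hGdiff x hx).continuousAt.continuousWithinAt
  have hφ'c : Continuous φ' :=
    ((hG'c.comp_continuous Real.continuous_exp hexp).mul Real.continuous_exp).div
      (hGc.comp_continuous Real.continuous_exp hexp) fun u => (hGpos _ (hexp u)).ne'
  have hφ'pos : ∀ u, 0 < φ' u := fun u =>
    div_pos (mul_pos (hG'pos _ (hexp u)) (Real.exp_pos u)) (hGpos _ (hexp u))
  have hφmono : StrictMono φ := fun u v huv =>
    Real.log_lt_log (hGpos _ (hexp u)) (hGmono (hexp u) (hexp v) (Real.exp_lt_exp.2 huv))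
  have hψmono : Monotone ψ := fun u v huv => by
    rw [← hφmono.le_iff_le, hφψ, hφψ]
    exact huv
  have hψc : Continuous ψ := hψmono.continuous_of_surjective fun u => ⟨φ u, hψφ u⟩
  have hψd : ∀ v, HasDerivAt ψ (φ' (ψ v))⁻¹ v := fun v =>
    (hφd (ψ v)).of_local_left_inverse hψc.continuousAt (hφ'pos _).ne'
      (Filter.Eventually.of_forall hφψ)
  have hψ'c : Continuous fun v => (φ' (ψ v))⁻¹ :=
    (hφ'c.comp hψc).inv₀ fun v => (hφ'pos _).ne'
  have hσφ : ∀ u, σhat (Real.exp (φ u)) = φ' u * σ (Real.exp u) := fun u => by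
    rw [hexpφ, hσhat _ (hGpos _ (hexp u)), hGinvl _ (hexp u)]
    simp only [φ']
    ring
  have hcost : ∀ u p, φ' u * p / σhat (Real.exp (φ u)) = p / σ (Real.exp u) := fun u p => by
    rw [hσφ, mul_div_mul_left _ _ (hφ'pos u).ne']
  have hconstraint : ∀ u,
      Real.exp u * η (F (Real.exp u)) ^ 2 = Real.exp (φ u) := fun u => by
    rw [hexpφ, hGdef _ (hexp u)]
  have hφV₀ : φ (Real.log V₀) = Real.log (G V₀) := by simp only [φ, Real.exp_log hV₀]
  congr 1
  ext y
  constructor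
  · rintro ⟨h, h', hac, h0, hK', rfl⟩
    refine ⟨_, _, hac.comp hφd hφ'c, ?_, ?_, ?_⟩
    · simp only [h0, hφV₀]
    · simpa only [hconstraint] using hK'
    · simp only [hcost]
  · rintro ⟨g, g', hac, g0, hK', rfl⟩
    refine ⟨_, _, hac.comp hψd hψ'c, ?_, ?_, ?_⟩
    · simp only [g0, ← hφV₀, hψφ]
    · simpa only [hconstraint, hφψ] using hK'
    · simp only [← hcost, hφψ, mul_inv_cancel_left₀ (hφ'pos _).ne']
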